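/- arXiv:2408.05077 — 5 statements merged into one kernel-verified Lean document; each statement's English description precedes it below -/
import Mathlib

section
/- Let d, ℓ ∈ ℕ, α ∈ (0,1], and let u : closure(ℝ^d₊) → ℝ^ℓ be α-Hölder continuous with u = 0 on the boundary hyperplane {x_d = 0}. Then for every ε > 0 and every x ∈ ℝ^d₊, |S_ε(u)(x) − u(x)| ≤ 3^α · [u]_{C^{0,α}} · ε^α. -/
open MeasureTheory
open scoped ENNReal NNReal

/-- The index of the last coordinate `x_d` in `ℝ^d`. -/
def halfIdx (d : ℕ) (hd : 0 < d) : Fin d := ⟨d - 1, Nat.sub_lt hd Nat.one_pos⟩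

/-- Extension by zero outside of the open half-space `{x : x_d > 0}`. -/
noncomputable def zeroExt {d : ℕ} (hd : 0 < d) {F : Type*} [Zero F]
    (u : EuclideanSpace ℝ (Fin d) → F) (x : EuclideanSpace ℝ (Fin d)) : F :=
  if 0 < x (halfIdx d hd) then u x else 0

/-- The rescaled mollifier `ρ_ε(x) = ε^{-d} ρ(x/ε)`. -/
noncomputable def molli {d : ℕ} (ρ : EuclideanSpace ℝ (Fin d) → ℝ) (ε : ℝ)
    (x : EuclideanSpace ℝ (Fin d)) : ℝ := (ε ^ d)⁻¹ * ρ (ε⁻¹ • x)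

/-- The convolution–translation operator
`S_ε(u)(x) = ∫ ρ_ε(y) ū(x − 2ε e_d − y) dy`. -/
noncomputable def convTrans {d ℓ : ℕ} (hd : 0 < d) (ρ : EuclideanSpace ℝ (Fin d) → ℝ)
    (ε : ℝ) (u : EuclideanSpace ℝ (Fin d) → EuclideanSpace ℝ (Fin ℓ))
    (x : EuclideanSpace ℝ (Fin d)) : EuclideanSpace ℝ (Fin ℓ) :=
  ∫ y, molli ρ ε y •
    zeroExt hd u (x - (2 * ε) • EuclideanSpace.single (halfIdx d hd) (1 : ℝ) - y)

lemma norm_zeroExt_sub_le {d : ℕ} (hd : 0 < d) {F : Type*} [NormedAddCommGroup F]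
    {α C : ℝ} (hα : 0 < α) {u : EuclideanSpace ℝ (Fin d) → F}
    (hC : ∀ x y : EuclideanSpace ℝ (Fin d), 0 ≤ x (halfIdx d hd) →
      0 ≤ y (halfIdx d hd) → ‖u x - u y‖ ≤ C * ‖x - y‖ ^ α)
    (hu : ∀ x : EuclideanSpace ℝ (Fin d), x (halfIdx d hd) = 0 → u x = 0)
    (hC0 : 0 ≤ C) {x : EuclideanSpace ℝ (Fin d)} (hx : 0 < x (halfIdx d hd))
    (z : EuclideanSpace ℝ (Fin d)) :
    ‖zeroExt hd u z - u x‖ ≤ C * ‖z - x‖ ^ α := by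
  unfold zeroExt
  split_ifs with hz
  · exact hC z x hz.le hx.le
  set p : EuclideanSpace ℝ (Fin d) :=
    x - x (halfIdx d hd) • EuclideanSpace.single (halfIdx d hd) (1 : ℝ) with hp
  have hp0 : p (halfIdx d hd) = 0 := by simp [hp]
  have hpx : ‖p - x‖ = x (halfIdx d hd) := by
    simp [hp, norm_smul, abs_of_pos hx]
  have hle : x (halfIdx d hd) ≤ ‖z - x‖ := by
    have h := PiLp.norm_apply_le (z - x) (halfIdx d hd)
    rw [PiLp.sub_apply, Real.norm_eq_abs] at h
    linarith [neg_abs_le (z (halfIdx d hd) - x (halfIdx d hd))]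
  have h := hC p x hp0.ge hx.le
  rw [hu p hp0, hpx] at h
  exact h.trans (by gcongr)

lemma nonneg_of_holder_bound {d : ℕ} (hd : 0 < d) {F : Type*} [NormedAddCommGroup F]
    {α C : ℝ} {u : EuclideanSpace ℝ (Fin d) → F}
    (hC : ∀ x y : EuclideanSpace ℝ (Fin d), 0 ≤ x (halfIdx d hd) →
      0 ≤ y (halfIdx d hd) → ‖u x - u y‖ ≤ C * ‖x - y‖ ^ α) : 0 ≤ C := by
  have h := hC (EuclideanSpace.single (halfIdx d hd) (1 : ℝ)) 0 (by simp) (by simp)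
  simp only [sub_zero, PiLp.norm_single, norm_one, Real.one_rpow, mul_one] at h
  exact (norm_nonneg _).trans h

lemma continuous_zeroExt {d : ℕ} (hd : 0 < d) {F : Type*} [NormedAddCommGroup F]
    {α C : ℝ} (hα : 0 < α) {u : EuclideanSpace ℝ (Fin d) → F}
    (hC : ∀ x y : EuclideanSpace ℝ (Fin d), 0 ≤ x (halfIdx d hd) →
      0 ≤ y (halfIdx d hd) → ‖u x - u y‖ ≤ C * ‖x - y‖ ^ α)
    (hu : ∀ x : EuclideanSpace ℝ (Fin d), x (halfIdx d hd) = 0 → u x = 0) :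
    Continuous (zeroExt hd u) := by
  have hC0 := nonneg_of_holder_bound hd hC
  have key : ∀ z w, ‖zeroExt hd u z - zeroExt hd u w‖ ≤ C * ‖z - w‖ ^ α := by
    intro z w
    by_cases hw : 0 < w (halfIdx d hd)
    · have h := norm_zeroExt_sub_le hd hα hC hu hC0 hw z
      simpa [zeroExt, hw] using h
    by_cases hz : 0 < z (halfIdx d hd)
    · have h := norm_zeroExt_sub_le hd hα hC hu hC0 hz w
      rw [norm_sub_rev, norm_sub_rev z w]
      simpa [zeroExt, hz] using h
    · simp only [zeroExt, hw, hz, if_false, sub_zero, norm_zero]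
      positivity
  refine continuous_iff_continuousAt.2 fun w => ?_
  refine tendsto_iff_norm_sub_tendsto_zero.2 (squeeze_zero (fun _ => norm_nonneg _)
    (fun z => key z w) ?_)
  have hc : Continuous fun z : EuclideanSpace ℝ (Fin d) => C * ‖z - w‖ ^ α :=
    continuous_const.mul ((continuous_id.sub continuous_const).norm.rpow_const
      fun _ => Or.inr hα.le)
  simpa [Real.zero_rpow hα.ne'] using hc.tendsto w

lemma norm_le_of_molli_ne_zero {d : ℕ} {ρ : EuclideanSpace ℝ (Fin d) → ℝ}
    (hρ : ∀ x : EuclideanSpace ℝ (Fin d), ρ x ≠ 0 → ‖x‖ ≤ 1) {ε : ℝ} (hε : 0 < ε)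
    {y : EuclideanSpace ℝ (Fin d)} (hy : molli ρ ε y ≠ 0) : ‖y‖ ≤ ε := by
  have h := hρ _ (right_ne_zero_of_mul hy)
  rwa [norm_smul, norm_inv, Real.norm_of_nonneg hε.le, inv_mul_le_iff₀ hε, mul_one] at h

lemma integral_molli {d : ℕ} (ρ : EuclideanSpace ℝ (Fin d) → ℝ) {ε : ℝ} (hε : 0 < ε) :
    ∫ y, molli ρ ε y = ∫ y, ρ y := by
  unfold molli
  rw [integral_const_mul, Measure.integral_comp_inv_smul_of_nonneg volume ρ hε.le,
    finrank_euclideanSpace_fin, smul_eq_mul, inv_mul_cancel_left₀ (pow_pos hε d).ne']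

/-- If `u : closure(ℝ^d₊) → ℝ^ℓ` is `α`-Hölder continuous with
Hölder seminorm at most `C` and vanishes on the boundary hyperplane, then for
every `ε > 0` and every `x` in the open half-space,
`|S_ε(u)(x) − u(x)| ≤ 3^α · C · ε^α`. -/
theorem stmt_3 (d ℓ : ℕ) (hd : 0 < d) (α : ℝ) (hα0 : 0 < α) (hα1 : α ≤ 1)
    (ρ : EuclideanSpace ℝ (Fin d) → ℝ)
    (hρ_smooth : ContDiff ℝ (⊤ : ℕ∞) ρ)
    (hρ_nonneg : ∀ x, 0 ≤ ρ x)
    (hρ_supp : ∀ x : EuclideanSpace ℝ (Fin d), ρ x ≠ 0 → ‖x‖ ≤ 1)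
    (hρ_radial : ∀ x y : EuclideanSpace ℝ (Fin d), ‖x‖ = ‖y‖ → ρ x = ρ y)
    (hρ_int : ∫ x, ρ x = 1)
    (u : EuclideanSpace ℝ (Fin d) → EuclideanSpace ℝ (Fin ℓ)) (C : ℝ)
    (hC : ∀ x y : EuclideanSpace ℝ (Fin d), 0 ≤ x (halfIdx d hd) →
      0 ≤ y (halfIdx d hd) → ‖u x - u y‖ ≤ C * ‖x - y‖ ^ α)
    (hu_bdry : ∀ x : EuclideanSpace ℝ (Fin d), x (halfIdx d hd) = 0 → u x = 0)
    (ε : ℝ) (hε : 0 < ε) (x : EuclideanSpace ℝ (Fin d))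
    (hx : 0 < x (halfIdx d hd)) :
    ‖convTrans hd ρ ε u x - u x‖ ≤ 3 ^ α * C * ε ^ α := by
  have hC0 := nonneg_of_holder_bound hd hC
  set e : EuclideanSpace ℝ (Fin d) := EuclideanSpace.single (halfIdx d hd) (1 : ℝ) with he
  have hmc : Continuous (molli ρ ε) :=
    continuous_const.mul (hρ_smooth.continuous.comp (continuous_const_smul _))
  have hms : HasCompactSupport (molli ρ ε) :=
    HasCompactSupport.intro (isCompact_closedBall 0 ε) fun y hy => by
      by_contra h
      exact hy (by simpa using norm_le_of_molli_ne_zero hρ_supp hε h)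
  have hmn : ∀ y, 0 ≤ molli ρ ε y := fun y =>
    mul_nonneg (by positivity) (hρ_nonneg _)
  have hmi : Integrable (molli ρ ε) := hmc.integrable_of_hasCompactSupport hms
  have hm1 : ∫ y, molli ρ ε y = 1 := (integral_molli ρ hε).trans hρ_int
  have hvc : Continuous fun y => zeroExt hd u (x - (2 * ε) • e - y) :=
    (continuous_zeroExt hd hα0 hC hu_bdry).comp (continuous_const.sub continuous_id)
  have hvi : Integrable fun y => molli ρ ε y • zeroExt hd u (x - (2 * ε) • e - y) :=
    (hmc.smul hvc).integrable_of_hasCompactSupport hms.smul_right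
  have heq : convTrans hd ρ ε u x - u x =
      ∫ y, molli ρ ε y • (zeroExt hd u (x - (2 * ε) • e - y) - u x) := by
    simp_rw [smul_sub]
    rw [integral_sub hvi (hmi.smul_const _), integral_smul_const, hm1, one_smul]
    rfl
  have hbound : ∀ y, ‖molli ρ ε y • (zeroExt hd u (x - (2 * ε) • e - y) - u x)‖ ≤
      molli ρ ε y * (C * (3 * ε) ^ α) := by
    intro y
    rw [norm_smul, Real.norm_of_nonneg (hmn y)]
    by_cases hy : molli ρ ε y = 0
    · simp [hy]
    have hdist : ‖x - (2 * ε) • e - y - x‖ ≤ 3 * ε := by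
      have h1 : ‖(2 * ε) • e‖ = 2 * ε := by
        simp [he, norm_smul, abs_of_pos hε]
      calc ‖x - (2 * ε) • e - y - x‖ = ‖(2 * ε) • e + y‖ := by
            rw [← norm_neg]; congr 1; abel
        _ ≤ ‖(2 * ε) • e‖ + ‖y‖ := norm_add_le _ _
        _ ≤ 3 * ε := by linarith [norm_le_of_molli_ne_zero hρ_supp hε hy]
    refine mul_le_mul_of_nonneg_left ?_ (hmn y)
    exact (norm_zeroExt_sub_le hd hα0 hC hu_bdry hC0 hx _).trans (by gcongr)
  calc ‖convTrans hd ρ ε u x - u x‖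
      ≤ ∫ y, molli ρ ε y * (C * (3 * ε) ^ α) := by
        rw [heq]
        exact norm_integral_le_of_norm_le (hmi.mul_const _) (.of_forall hbound)
    _ = 3 ^ α * C * ε ^ α := by
        rw [integral_mul_const, hm1, Real.mul_rpow (by norm_num) hε.le]
        ring
end

section
/- Let d, ℓ ∈ ℕ. There exists a constant c_d > 0, depending only on d and ρ, such that for every continuously differentiable w : ℝ^d → ℝ^ℓ whose gradient ∇w is locally integrable, every ε > 0, and every x ∈ ℝ^d, |∫_{ℝ^d} ρ_ε(y) w(x − 2ε e_d − y) dy − w(x)| ≤ c_d · ε · M(|∇w|)(x), where M denotes the Hardy–Littlewood maximal operator. -/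
open MeasureTheory
open scoped ENNReal NNReal

/-- The convolution–translation of a globally defined function:
`x ↦ ∫ ρ_ε(y) w(x − 2ε e_d − y) dy`. -/
noncomputable def convTransl {d ℓ : ℕ} (hd : 0 < d)
    (ρ : EuclideanSpace ℝ (Fin d) → ℝ) (ε : ℝ)
    (w : EuclideanSpace ℝ (Fin d) → EuclideanSpace ℝ (Fin ℓ))
    (x : EuclideanSpace ℝ (Fin d)) : EuclideanSpace ℝ (Fin ℓ) :=
  ∫ y, molli ρ ε y •
    w (x - (2 * ε) • EuclideanSpace.single (halfIdx d hd) (1 : ℝ) - y)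

/-- The Hardy–Littlewood maximal function, valued in `ℝ≥0∞`. -/
noncomputable def maxFn {d : ℕ} (f : EuclideanSpace ℝ (Fin d) → ℝ)
    (x : EuclideanSpace ℝ (Fin d)) : ℝ≥0∞ :=
  ⨆ (r : ℝ) (_ : 0 < r),
    (∫⁻ y in Metric.ball x r, (‖f y‖₊ : ℝ≥0∞)) / volume (Metric.ball x r)

/-- Affine change of variables for the Lebesgue integral of a nonnegative function. -/
theorem lintegral_comp_add_smul {d : ℕ} {G : EuclideanSpace ℝ (Fin d) → ℝ≥0∞}
    (hG : Measurable G) (a : EuclideanSpace ℝ (Fin d)) {r : ℝ} (hr : r ≠ 0) :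
    ∫⁻ z, G (a + r • z) = ENNReal.ofReal |(r ^ d)⁻¹| * ∫⁻ u, G u := by
  have h := lintegral_map (μ := (volume : Measure (EuclideanSpace ℝ (Fin d))))
    (hG.comp (measurable_const_add a)) (measurable_const_smul r)
  rw [Measure.map_addHaar_smul volume hr, lintegral_smul_measure] at h
  simp only [Function.comp_apply, finrank_euclideanSpace, Fintype.card_fin, smul_eq_mul] at h
  rw [← h, lintegral_add_left_eq_self]

/-- Averages over balls are bounded by the maximal function. -/
theorem setLIntegral_ball_le_maxFn {d : ℕ} (g : EuclideanSpace ℝ (Fin d) → ℝ)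
    (x : EuclideanSpace ℝ (Fin d)) {r : ℝ} (hr : 0 < r) :
    ∫⁻ y in Metric.ball x r, ‖g y‖ₑ ≤ volume (Metric.ball x r) * maxFn g x := by
  have h : (∫⁻ y in Metric.ball x r, ‖g y‖ₑ) / volume (Metric.ball x r) ≤ maxFn g x :=
    le_iSup₂ (f := fun (r : ℝ) (_ : 0 < r) =>
      (∫⁻ y in Metric.ball x r, (‖g y‖₊ : ℝ≥0∞)) / volume (Metric.ball x r)) r hr
  rw [mul_comm]
  exact (ENNReal.div_le_iff (Metric.measure_ball_pos volume x hr).ne'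
    measure_ball_lt_top.ne).1 h

/-- Integrals over off-centre balls of radius `s`, whose centre is at distance at most `2 * s`
from `x`, are controlled by the maximal function at `x`, uniformly in `s`. -/
theorem setLIntegral_comp_le_maxFn {d : ℕ} {g : EuclideanSpace ℝ (Fin d) → ℝ}
    (hg : Measurable g) (x : EuclideanSpace ℝ (Fin d)) {v : EuclideanSpace ℝ (Fin d)}
    (hv : ‖v‖ ≤ 2) {s : ℝ} (hs : 0 < s) :
    ∫⁻ z in Metric.closedBall 0 1, ‖g (x - s • (v + z))‖ₑ ≤
      ENNReal.ofReal (4 ^ d) * volume (Metric.ball (0 : EuclideanSpace ℝ (Fin d)) 1)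
        * maxFn g x := by
  set G : EuclideanSpace ℝ (Fin d) → ℝ≥0∞ :=
    (Metric.ball x (4 * s)).indicator fun u => ‖g u‖ₑ with hG
  have hGm : Measurable G := hg.enorm.indicator measurableSet_ball
  have hvol : volume (Metric.ball x (4 * s)) = ENNReal.ofReal ((4 * s) ^ d) *
      volume (Metric.ball (0 : EuclideanSpace ℝ (Fin d)) 1) := by
    rw [Measure.addHaar_ball_of_pos volume x (by positivity : 0 < 4 * s),
      finrank_euclideanSpace, Fintype.card_fin]
  calc ∫⁻ z in Metric.closedBall 0 1, ‖g (x - s • (v + z))‖ₑ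
      ≤ ∫⁻ z in Metric.closedBall 0 1, G ((x - s • v) + (-s) • z) := by
        refine setLIntegral_mono' measurableSet_closedBall fun z hz => le_of_eq ?_
        have hz1 : ‖z‖ ≤ 1 := by simpa using hz
        have he : (x - s • v) + (-s) • z = x - s • (v + z) := by
          rw [smul_add, neg_smul]; abel
        have hmem : x - s • (v + z) ∈ Metric.ball x (4 * s) := by
          rw [mem_ball_iff_norm, sub_sub_cancel_left, norm_neg, norm_smul, Real.norm_eq_abs,
            abs_of_pos hs]
          nlinarith [norm_add_le v z]
        rw [he, hG, Set.indicator_of_mem hmem]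
    _ ≤ ∫⁻ z, G ((x - s • v) + (-s) • z) := setLIntegral_le_lintegral _ _
    _ = ENNReal.ofReal ((s ^ d)⁻¹) * ∫⁻ u in Metric.ball x (4 * s), ‖g u‖ₑ := by
        rw [lintegral_comp_add_smul hGm _ (neg_ne_zero.2 hs.ne'), hG,
          lintegral_indicator measurableSet_ball, abs_inv, abs_pow, abs_neg, abs_of_pos hs]
    _ ≤ ENNReal.ofReal ((s ^ d)⁻¹) * (volume (Metric.ball x (4 * s)) * maxFn g x) := by
        gcongr
        exact setLIntegral_ball_le_maxFn g x (by positivity)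
    _ = _ := by
        rw [hvol, ← mul_assoc, ← mul_assoc, ← ENNReal.ofReal_mul (by positivity)]
        congr 3
        rw [mul_pow]
        field_simp

/-- A `C¹` function varies along a segment by at most the integral of the norm of its derivative. -/
theorem enorm_sub_le_lintegral_fderiv {E F : Type*} [NormedAddCommGroup E] [NormedSpace ℝ E]
    [NormedAddCommGroup F] [NormedSpace ℝ F] {w : E → F} (hw : ContDiff ℝ 1 w) (x v : E) :
    ‖w (x - v) - w x‖ₑ ≤ ∫⁻ t in Set.Icc (0 : ℝ) 1, ‖fderiv ℝ w (x - t • v)‖ₑ * ‖v‖ₑ := by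
  have hγ : ContDiff ℝ 1 fun t : ℝ => x - t • v := by fun_prop
  have h := enorm_sub_le_lintegral_deriv_of_contDiffOn_Icc (f := fun t : ℝ => w (x - t • v))
    (hw.comp hγ).contDiffOn zero_le_one
  simp only [one_smul, zero_smul, sub_zero] at h
  refine h.trans (lintegral_mono fun t => ?_)
  have hd : HasDerivAt (fun t : ℝ => x - t • v) (-v) t := by
    simpa using ((hasDerivAt_id t).smul_const v).const_sub x
  have hc : HasDerivAt (fun t : ℝ => w (x - t • v)) (fderiv ℝ w (x - t • v) (-v)) t :=
    ((hw.differentiable one_ne_zero (x - t • v)).hasFDerivAt).comp_hasDerivAt t hd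
  rw [hc.deriv, ← enorm_neg v]
  exact (fderiv ℝ w (x - t • v)).le_opENorm (-v)

/-- Rescaling the mollifier to unit scale in the convolution–translation. -/
theorem convTransl_eq_integral {d ℓ : ℕ} (hd : 0 < d) (ρ : EuclideanSpace ℝ (Fin d) → ℝ) {ε : ℝ}
    (hε : 0 < ε) (w : EuclideanSpace ℝ (Fin d) → EuclideanSpace ℝ (Fin ℓ))
    (x : EuclideanSpace ℝ (Fin d)) :
    convTransl hd ρ ε w x = ∫ z, ρ z • w (x - ε •
      ((2 : ℝ) • EuclideanSpace.single (halfIdx d hd) (1 : ℝ) + z)) := by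
  have h := Measure.integral_comp_inv_smul_of_nonneg volume (fun z => ρ z • w (x - ε •
      ((2 : ℝ) • EuclideanSpace.single (halfIdx d hd) (1 : ℝ) + z))) hε.le
  rw [finrank_euclideanSpace, Fintype.card_fin] at h
  rw [← inv_smul_smul₀ (pow_ne_zero d hε.ne') (∫ z, ρ z • w _), ← h, ← integral_smul, convTransl]
  congr 1
  funext y
  rw [molli, mul_smul, smul_add, smul_inv_smul₀ hε.ne', mul_comm 2 ε, mul_smul ε 2, sub_sub]

/-- There is a constant `c_d > 0`, depending only on `d` and
`ρ`, such that for every `C¹` function `w : ℝ^d → ℝ^ℓ` with locally integrable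
gradient, every `ε > 0`, and every `x ∈ ℝ^d`,
`|∫ ρ_ε(y) w(x − 2ε e_d − y) dy − w(x)| ≤ c_d · ε · M(|∇w|)(x)`. -/
theorem stmt_8 (d ℓ : ℕ) (hd : 0 < d)
    (ρ : EuclideanSpace ℝ (Fin d) → ℝ)
    (hρ_smooth : ContDiff ℝ (⊤ : ℕ∞) ρ)
    (hρ_nonneg : ∀ x, 0 ≤ ρ x)
    (hρ_supp : ∀ x : EuclideanSpace ℝ (Fin d), ρ x ≠ 0 → ‖x‖ ≤ 1)
    (hρ_radial : ∀ x y : EuclideanSpace ℝ (Fin d), ‖x‖ = ‖y‖ → ρ x = ρ y)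
    (hρ_int : ∫ x, ρ x = 1) :
    ∃ c : ℝ≥0, 0 < c ∧
      ∀ w : EuclideanSpace ℝ (Fin d) → EuclideanSpace ℝ (Fin ℓ),
        ContDiff ℝ 1 w →
        LocallyIntegrable (fun y => ‖fderiv ℝ w y‖) volume →
        ∀ ε : ℝ, 0 < ε → ∀ x : EuclideanSpace ℝ (Fin d),
          (‖convTransl hd ρ ε w x - w x‖₊ : ℝ≥0∞) ≤
            c * ENNReal.ofReal ε * maxFn (fun y => ‖fderiv ℝ w y‖) x := by
  have hK : HasCompactSupport ρ :=
    HasCompactSupport.intro (isCompact_closedBall 0 1) fun x hx => by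
      by_contra h
      exact hx (by simpa using hρ_supp x h)
  have hρc : Continuous ρ := hρ_smooth.continuous
  obtain ⟨C, hC⟩ := hK.exists_bound_of_continuous hρc
  set V := volume (Metric.ball (0 : EuclideanSpace ℝ (Fin d)) 1) with hV
  have hVt : V ≠ ∞ := measure_ball_lt_top.ne
  refine ⟨3 * C.toNNReal * ((4 : ℝ) ^ d).toNNReal * V.toNNReal + 1, by positivity, ?_⟩
  intro w hw _ ε hε x
  set g : EuclideanSpace ℝ (Fin d) → ℝ := fun y => ‖fderiv ℝ w y‖ with hg
  have hgc : Continuous g := (hw.continuous_fderiv one_ne_zero).norm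
  set v : EuclideanSpace ℝ (Fin d) :=
    (2 : ℝ) • EuclideanSpace.single (halfIdx d hd) (1 : ℝ) with hv_def
  have hv : ‖v‖ ≤ 2 := by simp [hv_def, norm_smul]
  have hwc := hw.continuous
  have hw_int : Integrable fun z => ρ z • w (x - ε • (v + z)) :=
    Continuous.integrable_of_hasCompactSupport (by fun_prop) hK.smul_right
  have hconst_int : Integrable fun z => ρ z • w x :=
    Continuous.integrable_of_hasCompactSupport (by fun_prop) hK.smul_right
  have hdiff : convTransl hd ρ ε w x - w x =
      ∫ z, ρ z • (w (x - ε • (v + z)) - w x) := by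
    simp only [smul_sub]
    rw [integral_sub hw_int hconst_int, integral_smul_const, hρ_int, one_smul,
      convTransl_eq_integral hd ρ hε]
  have hpt : ∀ z, ‖ρ z • (w (x - ε • (v + z)) - w x)‖ₑ ≤
      (Metric.closedBall 0 1).indicator (fun z => ENNReal.ofReal C * (3 * ENNReal.ofReal ε) *
        ∫⁻ t in Set.Icc (0 : ℝ) 1, ‖g (x - (t * ε) • (v + z))‖ₑ) z := by
    intro z
    by_cases hz : ρ z = 0
    · simp [hz]
    have hz1 : ‖z‖ ≤ 1 := hρ_supp z hz
    rw [Set.indicator_of_mem (by simpa using hz1), enorm_smul, mul_assoc]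
    gcongr
    · rw [← ofReal_norm]
      exact ENNReal.ofReal_le_ofReal (hC z)
    refine (enorm_sub_le_lintegral_fderiv hw x _).trans ?_
    rw [← lintegral_const_mul' _ _ (by finiteness)]
    refine lintegral_mono fun t => ?_
    simp only [hg, enorm_norm]
    rw [mul_comm, smul_smul]
    gcongr
    rw [← ofReal_norm, norm_smul, Real.norm_of_nonneg hε.le, mul_comm,
      ENNReal.ofReal_mul (norm_nonneg _)]
    gcongr
    refine ENNReal.ofReal_le_of_le_toReal ?_
    have := norm_add_le v z
    simp only [ENNReal.toReal_ofNat]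
    linarith
  have hswap : ∫⁻ z in Metric.closedBall (0 : EuclideanSpace ℝ (Fin d)) 1,
      ∫⁻ t in Set.Icc (0 : ℝ) 1, ‖g (x - (t * ε) • (v + z))‖ₑ ≤
      ENNReal.ofReal (4 ^ d) * V * maxFn g x := by
    rw [lintegral_lintegral_swap, restrict_Ioc_eq_restrict_Icc.symm]
    · calc _ ≤ ∫⁻ _t in Set.Ioc (0 : ℝ) 1, ENNReal.ofReal (4 ^ d) * V * maxFn g x :=
            setLIntegral_mono' measurableSet_Ioc fun t ht =>
              setLIntegral_comp_le_maxFn hgc.measurable x hv (mul_pos ht.1 hε)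
        _ = _ := by simp
    · have : Continuous (Function.uncurry fun (z : EuclideanSpace ℝ (Fin d)) (t : ℝ) =>
          ‖g (x - (t * ε) • (v + z))‖ₑ) := by
        simp only [Function.uncurry_def]
        fun_prop
      exact this.measurable.aemeasurable
  rw [hdiff]
  calc _ ≤ ∫⁻ z, ‖ρ z • (w (x - ε • (v + z)) - w x)‖ₑ := enorm_integral_le_lintegral_enorm _
    _ ≤ _ := lintegral_mono hpt
    _ = ENNReal.ofReal C * (3 * ENNReal.ofReal ε) *
        ∫⁻ z in Metric.closedBall (0 : EuclideanSpace ℝ (Fin d)) 1,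
        ∫⁻ t in Set.Icc (0 : ℝ) 1, ‖g (x - (t * ε) • (v + z))‖ₑ := by
      rw [lintegral_indicator measurableSet_closedBall,
        lintegral_const_mul' _ _ (by finiteness)]
    _ ≤ ENNReal.ofReal C * (3 * ENNReal.ofReal ε) *
        (ENNReal.ofReal (4 ^ d) * V * maxFn g x) := by gcongr
    _ = (3 * ENNReal.ofReal C * ENNReal.ofReal (4 ^ d) * V) * ENNReal.ofReal ε * maxFn g x := by
      ring
    _ ≤ _ := by
      push_cast
      rw [ENNReal.coe_toNNReal hVt]
      gcongr
      exact le_self_add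
end

section
/- (Constantin–E–Titi commutator identity.) Let d, ℓ ∈ ℕ and let u : ℝ^d → ℝ^ℓ be bounded and measurable. Then for every ε > 0 and every x ∈ ℝ^d, the following identity of ℓ×ℓ matrices holds: ∫_{ℝ^d} ρ_ε(y) u(x−y) ⊗ u(x−y) dy = u_ε(x) ⊗ u_ε(x) + ∫_{ℝ^d} ρ_ε(y) (u(x−y) − u(x)) ⊗ (u(x−y) − u(x)) dy − (u(x) − u_ε(x)) ⊗ (u(x) − u_ε(x)), where u_ε := ρ_ε ∗ u. -/
open MeasureTheory
open scoped ENNReal NNReal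

/-- The rescaled mollifier is integrable as soon as the mollifier is. -/
lemma integrable_molli {d : ℕ} {ρ : EuclideanSpace ℝ (Fin d) → ℝ} (hρ : Integrable ρ)
    {ε : ℝ} (hε : 0 < ε) : Integrable (molli ρ ε) :=
  (hρ.comp_smul (inv_ne_zero hε.ne')).const_mul _

/-- The covariance identity behind the Constantin–E–Titi commutator: for a weight `w` of total
mass one, the second moment equals the product of the means plus the second moment about `(a, b)`
minus the product of the deviations of `(a, b)` from the means. -/
lemma integral_weight_mul_mul_eq {α : Type*} [MeasurableSpace α] {μ : Measure α}
    {w f g : α → ℝ} (hw : Integrable w μ) (hw_one : ∫ y, w y ∂μ = 1)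
    (hf : Integrable (fun y => w y * f y) μ) (hg : Integrable (fun y => w y * g y) μ)
    (hfg : Integrable (fun y => w y * (f y * g y)) μ) (a b : ℝ) :
    ∫ y, w y * (f y * g y) ∂μ =
      (∫ y, w y * f y ∂μ) * (∫ y, w y * g y ∂μ) +
        (∫ y, w y * ((f y - a) * (g y - b)) ∂μ) -
        (a - ∫ y, w y * f y ∂μ) * (b - ∫ y, w y * g y ∂μ) := by
  have expand : ∫ y, w y * ((f y - a) * (g y - b)) ∂μ =
      (∫ y, w y * (f y * g y) ∂μ) - b * (∫ y, w y * f y ∂μ) - a * (∫ y, w y * g y ∂μ)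
        + a * b := by
    calc
      _ = ∫ y, (w y * (f y * g y) - b * (w y * f y) - a * (w y * g y) + a * b * w y) ∂μ := by
        congr 1 with y
        ring
      _ = _ := by
        have hfgf : Integrable (fun y => w y * (f y * g y) - b * (w y * f y)) μ :=
          hfg.sub (hf.const_mul b)
        have hfgfg : Integrable
            (fun y => w y * (f y * g y) - b * (w y * f y) - a * (w y * g y)) μ :=
          hfgf.sub (hg.const_mul a)
        rw [integral_add hfgfg (hw.const_mul _), integral_sub hfgf (hg.const_mul a),
          integral_sub hfg (hf.const_mul b)]
        simp only [integral_const_mul, hw_one, mul_one]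
  rw [expand]
  ring

/-- **Constantin–E–Titi commutator identity.** For bounded
measurable `u : ℝ^d → ℝ^ℓ`, every `ε > 0` and every `x`, the `ℓ×ℓ`-matrix
identity (stated entrywise)
`(u ⊗ u)_ε(x) = u_ε(x) ⊗ u_ε(x) + ∫ ρ_ε(y) δ_y u(x) ⊗ δ_y u(x) dy
  − (u(x) − u_ε(x)) ⊗ (u(x) − u_ε(x))`
holds, where `u_ε = ρ_ε ∗ u` and `δ_y u(x) = u(x−y) − u(x)`. -/
theorem stmt_13 (d ℓ : ℕ)
    (ρ : EuclideanSpace ℝ (Fin d) → ℝ)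
    (hρ_smooth : ContDiff ℝ (⊤ : ℕ∞) ρ)
    (hρ_nonneg : ∀ x, 0 ≤ ρ x)
    (hρ_supp : ∀ x : EuclideanSpace ℝ (Fin d), ρ x ≠ 0 → ‖x‖ ≤ 1)
    (hρ_radial : ∀ x y : EuclideanSpace ℝ (Fin d), ‖x‖ = ‖y‖ → ρ x = ρ y)
    (hρ_int : ∫ x, ρ x = 1)
    (u : EuclideanSpace ℝ (Fin d) → EuclideanSpace ℝ (Fin ℓ))
    (hu_meas : Measurable u) (B : ℝ) (hu_bdd : ∀ x, ‖u x‖ ≤ B)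
    (ε : ℝ) (hε : 0 < ε) (x : EuclideanSpace ℝ (Fin d)) (i j : Fin ℓ) :
    (∫ y, molli ρ ε y * (u (x - y) i * u (x - y) j)) =
      (∫ y, molli ρ ε y • u (x - y)) i * (∫ y, molli ρ ε y • u (x - y)) j +
        (∫ y, molli ρ ε y * ((u (x - y) i - u x i) * (u (x - y) j - u x j))) -
        (u x i - (∫ y, molli ρ ε y • u (x - y)) i) *
          (u x j - (∫ y, molli ρ ε y • u (x - y)) j) := by
  have hρ_integrable : Integrable ρ := by
    by_contra h
    exact zero_ne_one ((integral_undef h).symm.trans hρ_int)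
  have hw : Integrable (molli ρ ε) := integrable_molli hρ_integrable hε
  have hv : Measurable fun y => u (x - y) := hu_meas.comp (measurable_const.sub measurable_id)
  have hvk (k : Fin ℓ) : Measurable fun y => u (x - y) k := by fun_prop
  have hbk (k : Fin ℓ) (y : EuclideanSpace ℝ (Fin d)) : ‖u (x - y) k‖ ≤ B :=
    (PiLp.norm_apply_le (u (x - y)) k).trans (hu_bdd _)
  have hwk (k : Fin ℓ) : Integrable fun y => molli ρ ε y * u (x - y) k :=
    hw.mul_bdd (hvk k).aestronglyMeasurable (.of_forall (hbk k))
  have hwij : Integrable fun y => molli ρ ε y * (u (x - y) i * u (x - y) j) := by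
    simpa only [mul_assoc] using
      (hwk i).mul_bdd (hvk j).aestronglyMeasurable (.of_forall (hbk j))
  have hcoord (k : Fin ℓ) :
      (∫ y, molli ρ ε y • u (x - y)) k = ∫ y, molli ρ ε y * u (x - y) k := by
    have hint : Integrable fun y => molli ρ ε y • u (x - y) :=
      hw.smul_bdd B hv.aestronglyMeasurable (.of_forall fun y => hu_bdd _)
    exact ((EuclideanSpace.proj (𝕜 := ℝ) k).integral_comp_comm hint).symm
  rw [hcoord i, hcoord j]
  exact integral_weight_mul_mul_eq hw ((integral_molli ρ hε).trans hρ_int)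
    (hwk i) (hwk j) hwij (u x i) (u x j)
end

section
/- Let T ∈ (0, ∞), β ∈ (1, 2), and let v : (0,T) × ℝ³₊ → ℝ³ be measurable such that for a.e. t ∈ (0,T) the function v(t,·) is differentiable with gradient ∇v(t,·), and suppose: (a) ess sup_{t ∈ (0,T)} ‖v(t)‖_{L²(ℝ³₊)} < ∞; (b) ∫₀ᵀ ‖∇v(t)‖²_{L²(ℝ³₊)} dt < ∞; (c) ∫₀ᵀ ‖v(t)‖^β_{L^∞(ℝ³₊)} dt < ∞. Then for every r ∈ (1, 4/(4−β)), setting s := 2rβ/(4r + rβ − 4), one has ∫₀ᵀ ‖ |v(t)| · |∇v(t)| ‖_{L^r(ℝ³₊)}^s dt < ∞ (and s > 1). -/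
open MeasureTheory
open scoped ENNReal NNReal

/-- The fibrewise `L^∞` norm of a jointly measurable function is measurable in the parameter. -/
theorem measurable_eLpNorm_top_of_measurable_uncurry {X Y E : Type*} [MeasurableSpace X]
    [MeasurableSpace Y] [NormedAddCommGroup E] [MeasurableSpace E] [OpensMeasurableSpace E]
    {μ : Measure Y} [SFinite μ] {f : X → Y → E} (hf : Measurable (Function.uncurry f)) :
    Measurable fun x => eLpNorm (f x) ⊤ μ := by
  refine measurable_of_Iic fun c => ?_
  have h_eq : (fun x => eLpNorm (f x) ⊤ μ) ⁻¹' Set.Iic c =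
      (fun x => μ (Prod.mk x ⁻¹' {p : X × Y | c < ‖Function.uncurry f p‖ₑ})) ⁻¹' {0} := by
    ext x
    simp only [Set.mem_preimage, Set.mem_Iic, Set.mem_singleton_iff, eLpNorm_exponent_top,
      eLpNormEssSup]
    constructor
    · intro h
      have h_ae : ∀ᵐ y ∂μ, ‖f x y‖ₑ ≤ c :=
        (ENNReal.ae_le_essSup fun y => ‖f x y‖ₑ).mono fun y hy => hy.trans h
      simpa [ae_iff, Set.preimage] using h_ae
    · intro h
      refine essSup_le_of_ae_le c ?_
      change ∀ᵐ y ∂μ, ‖f x y‖ₑ ≤ c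
      simpa [ae_iff, Set.preimage] using h
  rw [h_eq]
  exact measurable_measure_prodMk_left (measurableSet_lt measurable_const hf.enorm)
    (measurableSet_singleton 0)

theorem eLpNorm_two_eq_lintegral_rpow {Y E : Type*} [MeasurableSpace Y] [NormedAddCommGroup E]
    {μ : Measure Y} (f : Y → E) :
    eLpNorm f 2 μ = (∫⁻ y, ‖f y‖ₑ ^ (2 : ℝ) ∂μ) ^ (1 / 2 : ℝ) := by
  rw [eLpNorm_eq_lintegral_rpow_enorm_toReal (by norm_num) (by norm_num), ENNReal.toReal_ofNat]

/-- Hölder's inequality combined with interpolation of the first factor between `L²` and `L^∞`. -/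
theorem eLpNorm_norm_mul_norm_le_of_one_le_of_le_two {Y E F : Type*} [MeasurableSpace Y]
    [NormedAddCommGroup E] [NormedAddCommGroup F] {μ : Measure Y} {f : Y → E} {g : Y → F}
    (hf : AEStronglyMeasurable f μ) (hg : AEStronglyMeasurable g μ) {r : ℝ} (hr1 : 1 ≤ r)
    (hr2 : r ≤ 2) :
    eLpNorm (fun y => ‖f y‖ * ‖g y‖) (ENNReal.ofReal r) μ ≤
      eLpNorm f ⊤ μ ^ ((2 * r - 2) / r) * eLpNorm f 2 μ ^ ((2 - r) / r) * eLpNorm g 2 μ := by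
  have hr0 : 0 < r := by linarith
  set M := eLpNorm f ⊤ μ with hM
  rw [eLpNorm_eq_lintegral_rpow_enorm_toReal (by simpa using hr0) ENNReal.ofReal_ne_top,
    ENNReal.toReal_ofReal hr0.le, eLpNorm_two_eq_lintegral_rpow f,
    eLpNorm_two_eq_lintegral_rpow g]
  have h_le : ∀ᵐ y ∂μ, ‖f y‖ₑ ≤ M := by
    rw [hM, eLpNorm_exponent_top]
    exact ae_le_eLpNormEssSup
  have hfm : AEMeasurable (fun y => ‖f y‖ₑ ^ (2 : ℝ)) μ := hf.enorm.pow_const 2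
  have hgm : AEMeasurable (fun y => ‖g y‖ₑ ^ (2 : ℝ)) μ := hg.enorm.pow_const 2
  have key : ∫⁻ y, ‖‖f y‖ * ‖g y‖‖ₑ ^ r ∂μ ≤ M ^ (2 * r - 2) *
      ((∫⁻ y, ‖f y‖ₑ ^ (2 : ℝ) ∂μ) ^ ((2 - r) / 2) *
        (∫⁻ y, ‖g y‖ₑ ^ (2 : ℝ) ∂μ) ^ (r / 2)) := by
    calc ∫⁻ y, ‖‖f y‖ * ‖g y‖‖ₑ ^ r ∂μ
        ≤ ∫⁻ y, M ^ (2 * r - 2) *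
            ((‖f y‖ₑ ^ (2 : ℝ)) ^ ((2 - r) / 2) * (‖g y‖ₑ ^ (2 : ℝ)) ^ (r / 2)) ∂μ := by
          refine lintegral_mono_ae ?_
          filter_upwards [h_le] with y hy
          rw [enorm_mul, enorm_norm, enorm_norm, ENNReal.mul_rpow_of_nonneg _ _ hr0.le,
            ← ENNReal.rpow_mul, ← ENNReal.rpow_mul, mul_div_cancel₀ _ (two_ne_zero' ℝ),
            mul_div_cancel₀ _ (two_ne_zero' ℝ), ← mul_assoc]
          gcongr
          calc ‖f y‖ₑ ^ r = ‖f y‖ₑ ^ (2 * r - 2) * ‖f y‖ₑ ^ (2 - r) := by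
                rw [← ENNReal.rpow_add_of_nonneg _ _ (by linarith) (by linarith)]
                ring_nf
            _ ≤ M ^ (2 * r - 2) * ‖f y‖ₑ ^ (2 - r) := by
                gcongr
                linarith
      _ = M ^ (2 * r - 2) * ∫⁻ y,
            (‖f y‖ₑ ^ (2 : ℝ)) ^ ((2 - r) / 2) * (‖g y‖ₑ ^ (2 : ℝ)) ^ (r / 2) ∂μ :=
          lintegral_const_mul'' _ ((hfm.pow_const _).mul (hgm.pow_const _))
      _ ≤ _ := by
          gcongr
          exact ENNReal.lintegral_mul_norm_pow_le hfm hgm (by linarith) (by linarith) (by ring)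
  have hr_inv : 0 ≤ 1 / r := by positivity
  calc (∫⁻ y, ‖‖f y‖ * ‖g y‖‖ₑ ^ r ∂μ) ^ (1 / r)
      ≤ (M ^ (2 * r - 2) * ((∫⁻ y, ‖f y‖ₑ ^ (2 : ℝ) ∂μ) ^ ((2 - r) / 2) *
        (∫⁻ y, ‖g y‖ₑ ^ (2 : ℝ) ∂μ) ^ (r / 2))) ^ (1 / r) := by gcongr
    _ = _ := by
        rw [ENNReal.mul_rpow_of_nonneg _ _ hr_inv, ENNReal.mul_rpow_of_nonneg _ _ hr_inv,
          ← ENNReal.rpow_mul, ← ENNReal.rpow_mul, ← ENNReal.rpow_mul, ← ENNReal.rpow_mul,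
          ← mul_assoc]
        congr 2
        · congr 1
          ring
        · congr 1
          ring
        · field_simp

/-- A crude form of Young's inequality in `ℝ≥0∞`. -/
theorem ENNReal.rpow_mul_rpow_one_sub_le_add (a b : ℝ≥0∞) {θ : ℝ} (h0 : 0 ≤ θ) (h1 : θ ≤ 1) :
    a ^ θ * b ^ (1 - θ) ≤ a + b := by
  have h1' : 0 ≤ 1 - θ := by linarith
  calc a ^ θ * b ^ (1 - θ) ≤ (a + b) ^ θ * (a + b) ^ (1 - θ) := by
        gcongr
        · exact le_self_add
        · exact le_add_self
    _ = a + b := by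
        rw [← ENNReal.rpow_add_of_nonneg _ _ h0 h1', add_sub_cancel, ENNReal.rpow_one]

/-- Let `v : (0,T) × ℝ³₊ → ℝ³` be measurable, spatially
differentiable for a.e. `t`, with `v ∈ L^∞(0,T; L²) `, `∇v ∈ L²(0,T; L²)`, and
`v ∈ L^β(0,T; L^∞)` for some `β ∈ (1,2)`. Then for every `r ∈ (1, 4/(4−β))`,
with `s := 2rβ/(4r + rβ − 4)`, one has `s > 1` and
`∫₀ᵀ ‖ |v(t)|·|∇v(t)| ‖_{L^r(ℝ³₊)}^s dt < ∞`. -/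
theorem stmt_15 (T : ℝ) (hT : 0 < T) (β : ℝ) (hβ1 : 1 < β) (hβ2 : β < 2)
    (v : ℝ → EuclideanSpace ℝ (Fin 3) → EuclideanSpace ℝ (Fin 3))
    (hv_meas : Measurable (Function.uncurry v))
    (hv_diff : ∀ᵐ t ∂(volume.restrict (Set.Ioo (0:ℝ) T)),
      ∀ x : EuclideanSpace ℝ (Fin 3), 0 < x 2 → DifferentiableAt ℝ (v t) x)
    (hv_LinfL2 : essSup
      (fun t => eLpNorm (v t) 2
        (volume.restrict {x : EuclideanSpace ℝ (Fin 3) | 0 < x 2}))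
      (volume.restrict (Set.Ioo (0:ℝ) T)) < ⊤)
    (hv_gradL2 : (∫⁻ t in Set.Ioo (0:ℝ) T,
      (eLpNorm (fun x => ‖fderiv ℝ (v t) x‖) 2
        (volume.restrict {x : EuclideanSpace ℝ (Fin 3) | 0 < x 2})) ^ (2:ℝ)) < ⊤)
    (hv_LbetaLinf : (∫⁻ t in Set.Ioo (0:ℝ) T,
      (eLpNorm (v t) ⊤
        (volume.restrict {x : EuclideanSpace ℝ (Fin 3) | 0 < x 2})) ^ β) < ⊤)
    (r : ℝ) (hr1 : 1 < r) (hr2 : r < 4 / (4 - β)) :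
    1 < 2 * r * β / (4 * r + r * β - 4) ∧
      (∫⁻ t in Set.Ioo (0:ℝ) T,
        (eLpNorm (fun x => ‖v t x‖ * ‖fderiv ℝ (v t) x‖) (ENNReal.ofReal r)
          (volume.restrict {x : EuclideanSpace ℝ (Fin 3) | 0 < x 2}))
            ^ (2 * r * β / (4 * r + r * β - 4))) < ⊤ := by
  have h4β : 0 < 4 - β := by linarith
  rw [lt_div_iff₀ h4β] at hr2
  have hr_two : r < 2 := by nlinarith
  have hr0 : 0 < r := by linarith
  have hD : 0 < 4 * r + r * β - 4 := by nlinarith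
  have hs1 : 1 < 2 * r * β / (4 * r + r * β - 4) := by
    rw [lt_div_iff₀ hD]
    linarith
  refine ⟨hs1, ?_⟩
  have h_exp : (2 * r - 2) / r * (2 * r * β / (4 * r + r * β - 4)) =
      β * (1 - 2 * r * β / (4 * r + r * β - 4) / 2) := by
    have hD' := hD.ne'
    have hr' := hr0.ne'
    generalize hd : 4 * r + r * β - 4 = d at hD'
    field_simp
    linear_combination hd
  have hs2 : 2 * r * β / (4 * r + r * β - 4) ≤ 2 := by
    rw [div_le_iff₀ hD]
    linarith
  set s := 2 * r * β / (4 * r + r * β - 4)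
  have hs0 : 0 ≤ s := by linarith
  set μ := (volume : Measure (EuclideanSpace ℝ (Fin 3))).restrict {x | 0 < x 2}
  set A := essSup (fun t => eLpNorm (v t) 2 μ) (volume.restrict (Set.Ioo (0 : ℝ) T))
  set K := (A ^ ((2 - r) / r)) ^ s
  have h_exp_nonneg : 0 ≤ (2 - r) / r := div_nonneg (by linarith) hr0.le
  have hK : K ≠ ⊤ :=
    ENNReal.rpow_ne_top_of_nonneg hs0 (ENNReal.rpow_ne_top_of_nonneg h_exp_nonneg hv_LinfL2.ne)
  have hA : ∀ᵐ t ∂(volume.restrict (Set.Ioo (0 : ℝ) T)), eLpNorm (v t) 2 μ ≤ A :=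
    ENNReal.ae_le_essSup _
  calc _ ≤ ∫⁻ t in Set.Ioo (0 : ℝ) T, K * (eLpNorm (v t) ⊤ μ ^ β +
          eLpNorm (fun x => ‖fderiv ℝ (v t) x‖) 2 μ ^ (2 : ℝ)) := by
        refine lintegral_mono_ae ?_
        filter_upwards [hA] with t ht
        have hvt : Measurable (v t) := hv_meas.of_uncurry_left
        have h_holder := eLpNorm_norm_mul_norm_le_of_one_le_of_le_two (μ := μ)
          hvt.aestronglyMeasurable
          (measurable_fderiv ℝ (v t)).aestronglyMeasurable hr1.le hr_two.le
        rw [← eLpNorm_norm (fderiv ℝ (v t))] at h_holder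
        set M := eLpNorm (v t) ⊤ μ
        set G := eLpNorm (fun x => ‖fderiv ℝ (v t) x‖) 2 μ
        calc _ ≤ (M ^ ((2 * r - 2) / r) * A ^ ((2 - r) / r) * G) ^ s := by
              refine ENNReal.rpow_le_rpow (h_holder.trans ?_) hs0
              gcongr
          _ = K * ((M ^ β) ^ (1 - s / 2) * (G ^ (2 : ℝ)) ^ (1 - (1 - s / 2))) := by
              rw [ENNReal.mul_rpow_of_nonneg _ _ hs0, ENNReal.mul_rpow_of_nonneg _ _ hs0,
                ← ENNReal.rpow_mul M, ← ENNReal.rpow_mul M, ← ENNReal.rpow_mul G, h_exp,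
                sub_sub_cancel, mul_div_cancel₀ _ (two_ne_zero' ℝ)]
              ring
          _ ≤ K * (M ^ β + G ^ (2 : ℝ)) := by
              gcongr
              exact ENNReal.rpow_mul_rpow_one_sub_le_add _ _ (by linarith) (by linarith)
    _ < ⊤ := by
        rw [lintegral_const_mul' _ _ hK, lintegral_add_left
          ((measurable_eLpNorm_top_of_measurable_uncurry hv_meas).pow_const β)]
        exact ENNReal.mul_lt_top hK.lt_top (ENNReal.add_lt_top.2 ⟨hv_LbetaLinf, hv_gradL2⟩)
end

section
/- Let d, ℓ ∈ ℕ, let a : ℝ^d → ℝ^d be continuously differentiable, bounded, and divergence-free (Σ_{j=1}^d ∂_j a_j = 0 everywhere), and let b : ℝ^d → ℝ^ℓ be continuously differentiable with compact support. Then ∫_{ℝ^d} Σ_{i=1}^ℓ Σ_{j=1}^d b_i(x) a_j(x) ∂_j b_i(x) dx = 0. -/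
open MeasureTheory

/-- **Integration by parts for the divergence**: for a `C¹` vector field `a` and a compactly
supported `C¹` function `g`, `∫ a · ∇g = -∫ (div a) g`. -/
theorem integral_sum_mul_fderiv_single_eq_neg_integral_div_mul {ι : Type*} [Fintype ι]
    [DecidableEq ι] {a : EuclideanSpace ℝ ι → EuclideanSpace ℝ ι} {g : EuclideanSpace ℝ ι → ℝ}
    (ha : ContDiff ℝ 1 a) (hg : ContDiff ℝ 1 g) (hg_supp : HasCompactSupport g) :
    ∫ x, ∑ j, a x j * fderiv ℝ g x (EuclideanSpace.single j (1 : ℝ)) =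
      -∫ x, (∑ j, fderiv ℝ a x (EuclideanSpace.single j (1 : ℝ)) j) * g x := by
  have ha_diff : Differentiable ℝ a := ha.differentiable one_ne_zero
  have ha_comp (j : ι) : Differentiable ℝ fun x ↦ a x j := by fun_prop
  have h_fderiv (j : ι) (x v : EuclideanSpace ℝ ι) :
      fderiv ℝ (fun y ↦ a y j) x v = fderiv ℝ a x v j := by
    have h := (EuclideanSpace.proj j : EuclideanSpace ℝ ι →L[ℝ] ℝ).hasFDerivAt.comp x
      (ha_diff x).hasFDerivAt
    exact congrArg (· v) h.fderiv
  have ha_cont : Continuous (fderiv ℝ a) := ha.continuous_fderiv one_ne_zero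
  have hg_cont : Continuous (fderiv ℝ g) := hg.continuous_fderiv one_ne_zero
  have ha_c : Continuous a := ha.continuous
  have hg_c : Continuous g := hg.continuous
  have h_left (j : ι) :
      Integrable fun x ↦ a x j * fderiv ℝ g x (EuclideanSpace.single j (1 : ℝ)) :=
    Continuous.integrable_of_hasCompactSupport (by fun_prop)
      (hg_supp.fderiv_apply ℝ _).mul_left
  have h_right (j : ι) :
      Integrable fun x ↦ fderiv ℝ a x (EuclideanSpace.single j (1 : ℝ)) j * g x :=
    Continuous.integrable_of_hasCompactSupport (by fun_prop) hg_supp.mul_left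
  have h_prod (j : ι) : Integrable fun x ↦ a x j * g x :=
    Continuous.integrable_of_hasCompactSupport (by fun_prop) hg_supp.mul_left
  simp_rw [Finset.sum_mul]
  rw [integral_finsetSum _ fun j _ ↦ h_left j, integral_finsetSum _ fun j _ ↦ h_right j,
    ← Finset.sum_neg_distrib]
  refine Finset.sum_congr rfl fun j _ ↦ ?_
  simp_rw [← h_fderiv] at h_right ⊢
  exact integral_mul_fderiv_eq_neg_fderiv_mul_of_integrable (h_right j) (h_left j) (h_prod j)
    (fun x _ ↦ ha_comp j x) (fun x _ ↦ hg.differentiable one_ne_zero x)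

/-- If `a : ℝ^d → ℝ^d` is `C¹`, bounded, and divergence-free,
and `b : ℝ^d → ℝ^ℓ` is `C¹` with compact support, then
`∫ Σ_i Σ_j b_i a_j ∂_j b_i dx = 0`. -/
theorem stmt_16 (d ℓ : ℕ)
    (a : EuclideanSpace ℝ (Fin d) → EuclideanSpace ℝ (Fin d))
    (ha_C1 : ContDiff ℝ 1 a) (B : ℝ) (ha_bdd : ∀ x, ‖a x‖ ≤ B)
    (ha_div : ∀ x : EuclideanSpace ℝ (Fin d),
      ∑ j : Fin d, fderiv ℝ a x (EuclideanSpace.single j (1 : ℝ)) j = 0)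
    (b : EuclideanSpace ℝ (Fin d) → EuclideanSpace ℝ (Fin ℓ))
    (hb_C1 : ContDiff ℝ 1 b) (hb_supp : HasCompactSupport b) :
    ∫ x, ∑ i : Fin ℓ, ∑ j : Fin d,
      b x i * (a x j * fderiv ℝ b x (EuclideanSpace.single j (1 : ℝ)) i) = 0 := by
  have h_fderiv (x v : EuclideanSpace ℝ (Fin d)) :
      fderiv ℝ (fun y ↦ ‖b y‖ ^ 2) x v = 2 * ∑ i, b x i * fderiv ℝ b x v i := by
    rw [((hb_C1.differentiable one_ne_zero x).hasFDerivAt.norm_sq).fderiv]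
    simp [PiLp.inner_apply, mul_comm]
  have hg_supp : HasCompactSupport fun x ↦ ‖b x‖ ^ 2 :=
    hb_supp.comp_left (g := fun y ↦ ‖y‖ ^ 2) (by simp)
  have key := integral_sum_mul_fderiv_single_eq_neg_integral_div_mul ha_C1
    (hb_C1.norm_sq ℝ) hg_supp
  simp only [ha_div, zero_mul, integral_zero, neg_zero, h_fderiv] at key
  have h_eq (x : EuclideanSpace ℝ (Fin d)) :
      ∑ j, a x j * (2 * ∑ i, b x i * fderiv ℝ b x (EuclideanSpace.single j (1 : ℝ)) i) =
        2 * ∑ i, ∑ j, b x i * (a x j * fderiv ℝ b x (EuclideanSpace.single j (1 : ℝ)) i) := by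
    rw [Finset.sum_comm]
    simp only [Finset.mul_sum]
    refine Finset.sum_congr rfl fun j _ ↦ Finset.sum_congr rfl fun i _ ↦ ?_
    ring
  simp_rw [h_eq, integral_const_mul] at key
  exact (mul_eq_zero.mp key).resolve_left two_ne_zero
end
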